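/- arXiv:2107.06385 — 2 statements merged into one kernel-verified Lean document; each statement's English description precedes it below -/
import Mathlib

section
/- Let g ∈ K[x] and let ĝ ∈ K[x] be the formal integral of g, i.e., ĝ′ = g and ĝ(0) = 0. Then Δ_g = exp(ad(ĝ(f))): for every a ∈ P_λ, Δ_g(a) = Σ_{i≥0} (1/i!)·(ad(ĝ(f)))^i(a), where ad(ĝ(f))(a) = {ĝ(f), a} and the sum has only finitely many nonzero terms. -/
noncomputable section

open scoped Pointwise

variable (K : Type*) [Field K] [IsAlgClosed K] [CharZero K] (lam : K)

/-- `P_λ`: the quotient of `K[X,Y,Z]` by the ideal generated by `4XZ + Y² - λ`. -/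
abbrev PQ : Type _ :=
  MvPolynomial (Fin 3) K ⧸
    Ideal.span {4 * MvPolynomial.X 0 * MvPolynomial.X 2 + MvPolynomial.X 1 ^ 2 -
      MvPolynomial.C lam}

/-- `e`, the image of `X`. -/
def pe : PQ K lam := Ideal.Quotient.mk _ (MvPolynomial.X 0)

/-- `h`, the image of `Y`. -/
def ph : PQ K lam := Ideal.Quotient.mk _ (MvPolynomial.X 1)

/-- `f`, the image of `Z`. -/
def pf : PQ K lam := Ideal.Quotient.mk _ (MvPolynomial.X 2)

/-- A Poisson bracket on `P_λ`: a `K`-bilinear Lie bracket satisfying the Leibniz rule with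
`{e,f} = h`, `{h,e} = 2e`, `{h,f} = -2f`. -/
structure PoissonBr : Type _ where
  br : PQ K lam → PQ K lam → PQ K lam
  add_left : ∀ a b c, br (a + b) c = br a c + br b c
  add_right : ∀ a b c, br a (b + c) = br a b + br a c
  smul_left : ∀ (μ : K) (a b), br (μ • a) b = μ • br a b
  smul_right : ∀ (μ : K) (a b), br a (μ • b) = μ • br a b
  alternate : ∀ a, br a a = 0
  jacobi : ∀ a b c, br a (br b c) + br b (br c a) + br c (br a b) = 0
  leibniz : ∀ a b c, br a (b * c) = b * br a c + br a b * c
  br_ef : br (pe K lam) (pf K lam) = ph K lam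
  br_he : br (ph K lam) (pe K lam) = 2 * pe K lam
  br_hf : br (ph K lam) (pf K lam) = -2 * pf K lam

variable {K lam}

/-- `Aut(P_λ)`: the subgroup of `K`-algebra automorphisms of `P_λ` preserving the bracket.
Multiplication is composition: `(θ * φ) x = θ (φ x)`. -/
def PAut (B : PoissonBr K lam) : Subgroup ((PQ K lam) ≃ₐ[K] (PQ K lam)) where
  carrier := {φ | ∀ a b, φ (B.br a b) = B.br (φ a) (φ b)}
  one_mem' := fun _ _ => rfl
  mul_mem' := by
    intro φ ψ hφ hψ a b
    show φ (ψ (B.br a b)) = _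
    rw [hψ, hφ]
    rfl
  inv_mem' := by
    intro φ hφ a b
    apply φ.injective
    show φ (φ.symm (B.br a b)) = φ (B.br (φ.symm a) (φ.symm b))
    rw [hφ]
    simp

/-- `D` is the automorphism `Δ_g`:
`e ↦ e − g(f)h − f·g(f)²`, `h ↦ h + 2f·g(f)`, `f ↦ f`. -/
def IsDelta (B : PoissonBr K lam) (g : Polynomial K) (D : ↥(PAut B)) : Prop :=
  D.val (pe K lam) =
      pe K lam - Polynomial.aeval (pf K lam) g * ph K lam -
        pf K lam * Polynomial.aeval (pf K lam) g ^ 2 ∧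
  D.val (ph K lam) = ph K lam + 2 * (pf K lam * Polynomial.aeval (pf K lam) g) ∧
  D.val (pf K lam) = pf K lam

/-- `D` is the automorphism `τ`: `e ↦ f`, `h ↦ -h`, `f ↦ e`. -/
def IsTau (B : PoissonBr K lam) (D : ↥(PAut B)) : Prop :=
  D.val (pe K lam) = pf K lam ∧ D.val (ph K lam) = -ph K lam ∧ D.val (pf K lam) = pe K lam

/-- `D` is the automorphism `τ_α`: `e ↦ f`, `h ↦ -h + 2αf`, `f ↦ e + αh - α²f`. -/
def IsTauA (B : PoissonBr K lam) (α : K) (D : ↥(PAut B)) : Prop :=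
  D.val (pe K lam) = pf K lam ∧
  D.val (ph K lam) = -ph K lam + (2 * α) • pf K lam ∧
  D.val (pf K lam) = pe K lam + α • ph K lam - α ^ 2 • pf K lam

/-- `D` is the hyperbolic rotation `H_β`: `e ↦ βe`, `h ↦ h`, `f ↦ β⁻¹f`. -/
def IsHRot (B : PoissonBr K lam) (β : Kˣ) (D : ↥(PAut B)) : Prop :=
  D.val (pe K lam) = (β : K) • pe K lam ∧
  D.val (ph K lam) = ph K lam ∧
  D.val (pf K lam) = (β : K)⁻¹ • pf K lam

/-- The set `C` of linear triangular automorphisms: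
`e ↦ βe + αh − (α²/β)f`, `h ↦ h − (2α/β)f`, `f ↦ β⁻¹f` with `α ∈ K`, `β ∈ Kˣ`. -/
def CsetLT (B : PoissonBr K lam) : Set ↥(PAut B) :=
  {D | ∃ (α : K) (β : Kˣ),
    D.val (pe K lam) = (β : K) • pe K lam + α • ph K lam - (α ^ 2 / (β : K)) • pf K lam ∧
    D.val (ph K lam) = ph K lam - (2 * α / (β : K)) • pf K lam ∧
    D.val (pf K lam) = (β : K)⁻¹ • pf K lam}

open Polynomial in
/-- The extension of a derivation of `A` to `A[X]` killing `X`, acting coefficientwise. -/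
def Derivation.mapCoeff {R A : Type*} [CommRing R] [CommRing A] [Algebra R A]
    (d : Derivation R A A) : Derivation R A[X] A[X] :=
  PolynomialModule.equivPolynomialSelf.compDer d.mapCoeffs

@[simp]
theorem Derivation.coeff_mapCoeff {R A : Type*} [CommRing R] [CommRing A] [Algebra R A]
    (d : Derivation R A A) (p : Polynomial A) (n : ℕ) :
    (d.mapCoeff p).coeff n = d (p.coeff n) := rfl

open Polynomial in
/-- If a polynomial curve `p` solves `p' = d p` coefficientwise, then its coefficients are the
divided iterates of `d` at `p(0)`. -/
theorem Derivation.iterate_eq_factorial_smul_coeff {R A : Type*} [CommRing R] [CommRing A]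
    [Algebra R A] (d : Derivation R A A) {p : A[X]} (hp : derivative p = d.mapCoeff p) (n : ℕ) :
    d^[n] (p.coeff 0) = (n.factorial : A) * p.coeff n := by
  induction n with
  | zero => simp
  | succ n ih =>
    have h := congrArg (fun q => q.coeff n) hp
    simp only [coeff_derivative, Derivation.coeff_mapCoeff] at h
    rw [Function.iterate_succ_apply', ih, d.leibniz, d.map_natCast, ← h, Nat.factorial_succ]
    push_cast
    simp only [smul_eq_mul]
    ring

namespace PoissonBr

/-- The Hamiltonian derivation `{a, −}`. -/
def ad (B : PoissonBr K lam) (a : PQ K lam) : Derivation K (PQ K lam) (PQ K lam) :=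
  Derivation.mk'
    { toFun := B.br a
      map_add' := B.add_right a
      map_smul' := fun μ b => B.smul_right μ a b }
    fun b c => by
      change B.br a (b * c) = b * B.br a c + c * B.br a b
      rw [B.leibniz, mul_comm c]

omit [IsAlgClosed K] [CharZero K] in
@[simp]
theorem ad_apply (B : PoissonBr K lam) (a b : PQ K lam) : B.ad a b = B.br a b := rfl

omit [IsAlgClosed K] [CharZero K] in
theorem br_swap (B : PoissonBr K lam) (a b : PQ K lam) : B.br a b = -B.br b a := by
  have h := B.alternate (a + b)
  rw [B.add_left, B.add_right, B.add_right, B.alternate, B.alternate, zero_add, add_zero] at h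
  exact eq_neg_of_add_eq_zero_left h

omit [IsAlgClosed K] [CharZero K] in
theorem br_aeval_left (B : PoissonBr K lam) (p : Polynomial K) (a b : PQ K lam) :
    B.br (Polynomial.aeval a p) b =
      Polynomial.aeval a (Polynomial.derivative p) * B.br a b := by
  rw [B.br_swap, ← B.ad_apply, Derivation.map_aeval, B.br_swap a b, smul_eq_mul, B.ad_apply]
  ring

end PoissonBr

open Polynomial in
/-- `p` is a polynomial integral curve of the derivation `d` going from `a` at time `0` to `b` at
time `1`. -/
structure IsPolyFlow {R A : Type*} [CommRing R] [CommRing A] [Algebra R A]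
    (d : Derivation R A A) (a b : A) (p : A[X]) : Prop where
  derivative_eq : derivative p = d.mapCoeff p
  eval_zero : p.eval 0 = a
  eval_one : p.eval 1 = b

namespace IsPolyFlow

variable {R A : Type*} [CommRing R] [CommRing A] [Algebra R A] {d : Derivation R A A}
  {a b a' b' : A} {p q : Polynomial A}

theorem add (hp : IsPolyFlow d a b p) (hq : IsPolyFlow d a' b' q) :
    IsPolyFlow d (a + a') (b + b') (p + q) where
  derivative_eq := by
    rw [Polynomial.derivative_add, map_add, hp.derivative_eq, hq.derivative_eq]
  eval_zero := by rw [Polynomial.eval_add, hp.eval_zero, hq.eval_zero]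
  eval_one := by rw [Polynomial.eval_add, hp.eval_one, hq.eval_one]

theorem mul (hp : IsPolyFlow d a b p) (hq : IsPolyFlow d a' b' q) :
    IsPolyFlow d (a * a') (b * b') (p * q) where
  derivative_eq := by
    rw [Polynomial.derivative_mul, Derivation.leibniz, hp.derivative_eq, hq.derivative_eq,
      smul_eq_mul, smul_eq_mul]
    ring
  eval_zero := by rw [Polynomial.eval_mul, hp.eval_zero, hq.eval_zero]
  eval_one := by rw [Polynomial.eval_mul, hp.eval_one, hq.eval_one]

theorem const (h : d a = 0) : IsPolyFlow d a a (Polynomial.C a) where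
  derivative_eq := by ext; simp [Polynomial.coeff_C, apply_ite d, h]
  eval_zero := Polynomial.eval_C
  eval_one := Polynomial.eval_C

open Polynomial in
theorem quadratic {u v : A} (ha : d a = u) (hu : d u = 2 * v) (hv : d v = 0) :
    IsPolyFlow d a (a + u + v) (C a + C u * X + C v * X ^ 2) where
  derivative_eq := by
    have hC (c : A) : d.mapCoeff (C c) = C (d c) := by
      ext n; rw [Derivation.coeff_mapCoeff, coeff_C, coeff_C]; split_ifs <;> simp
    have hX : d.mapCoeff (X : A[X]) = 0 := by
      ext n; rw [Derivation.coeff_mapCoeff, coeff_X]; split_ifs <;> simp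
    simp [hC, hX, ha, hu, hv, Derivation.leibniz_pow, map_ofNat C 2]
    ring
  eval_zero := by simp
  eval_one := by simp

end IsPolyFlow

omit [IsAlgClosed K] [CharZero K] in
theorem exists_isPolyFlow (B : PoissonBr K lam) (ghat : Polynomial K) (D : PAut B)
    (hD : IsDelta B (Polynomial.derivative ghat) D) (a : PQ K lam) :
    ∃ p, IsPolyFlow (B.ad (Polynomial.aeval (pf K lam) ghat)) a (D.val a) p := by
  obtain ⟨he, hh, hf⟩ := hD
  set G := Polynomial.aeval (pf K lam) (Polynomial.derivative ghat) with hG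
  set d := B.ad (Polynomial.aeval (pf K lam) ghat) with hd
  have hd_apply (x : PQ K lam) : d x = G * B.br (pf K lam) x := B.br_aeval_left ghat _ x
  have df : d (pf K lam) = 0 := by rw [hd_apply, B.alternate, mul_zero]
  have dh : d (ph K lam) = 2 * (pf K lam * G) := by
    rw [hd_apply, B.br_swap, B.br_hf]; ring
  have de : d (pe K lam) = -(G * ph K lam) := by
    rw [hd_apply, B.br_swap, B.br_ef]; ring
  have dG : d G = 0 := by rw [hG, Derivation.map_aeval, df, smul_zero]
  have dfG : d (pf K lam * G) = 0 := by simp [Derivation.leibniz, df, dG]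
  obtain ⟨q, rfl⟩ := Ideal.Quotient.mk_surjective a
  induction q using MvPolynomial.induction_on with
  | C r =>
    have h : D.val (algebraMap K (PQ K lam) r) = algebraMap K (PQ K lam) r := D.val.commutes r
    change ∃ q, IsPolyFlow d (algebraMap K (PQ K lam) r) (D.val (algebraMap K (PQ K lam) r)) q
    rw [h]
    exact ⟨_, IsPolyFlow.const (d.map_algebraMap r)⟩
  | add p q hp hq =>
    obtain ⟨_, hp⟩ := hp
    obtain ⟨_, hq⟩ := hq
    rw [map_add, map_add]
    exact ⟨_, hp.add hq⟩
  | mul_X p i hp =>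
    obtain ⟨_, hp⟩ := hp
    rw [map_mul, map_mul]
    suffices h : ∃ q, IsPolyFlow d (Ideal.Quotient.mk _ (MvPolynomial.X i))
        (D.val (Ideal.Quotient.mk _ (MvPolynomial.X i))) q from
      h.elim fun _ hq => ⟨_, hp.mul hq⟩
    fin_cases i
    · change ∃ q, IsPolyFlow d (pe K lam) (D.val (pe K lam)) q
      have he' : D.val (pe K lam) = pe K lam + -(G * ph K lam) + -(pf K lam * G * G) := by
        rw [he]; ring
      rw [he']
      refine ⟨_, IsPolyFlow.quadratic de ?_ ?_⟩
      · rw [map_neg, Derivation.leibniz, dG, dh, smul_eq_mul, smul_zero]; ring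
      · rw [map_neg, Derivation.leibniz, dG, dfG, smul_zero, smul_zero, add_zero, neg_zero]
    · change ∃ q, IsPolyFlow d (ph K lam) (D.val (ph K lam)) q
      rw [hh, ← add_zero (ph K lam + _)]
      refine ⟨_, IsPolyFlow.quadratic dh ?_ (map_zero d)⟩
      rw [two_mul, map_add, dfG]; simp
    · change ∃ q, IsPolyFlow d (pf K lam) (D.val (pf K lam)) q
      rw [hf]
      exact ⟨_, IsPolyFlow.const df⟩

/-- If `ĝ` is the formal integral of `g` (`ĝ′ = g`, `ĝ(0) = 0`), then
`Δ_g = exp(ad(ĝ(f)))`: for every `a`, the iterates `ad(ĝ(f))^i a` eventually vanish and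
`Δ_g(a) = Σ_i (1/i!) · ad(ĝ(f))^i a`. -/
theorem delta_eq_exp_ad (B : PoissonBr K lam)
    (g ghat : Polynomial K)
    (hder : Polynomial.derivative ghat = g) (h0 : Polynomial.eval 0 ghat = 0)
    (Δg : ↥(PAut B)) (hΔg : IsDelta B g Δg) :
    ∀ a : PQ K lam, ∃ N : ℕ,
      (∀ i : ℕ, N ≤ i → (fun x => B.br (Polynomial.aeval (pf K lam) ghat) x)^[i] a = 0) ∧
      Δg.val a = ∑ i ∈ Finset.range N,
        ((Nat.factorial i : K)⁻¹) •
          (fun x => B.br (Polynomial.aeval (pf K lam) ghat) x)^[i] a := by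
  intro a
  subst hder
  obtain ⟨p, hp⟩ := exists_isPolyFlow B ghat Δg hΔg a
  have hit (i : ℕ) : (fun x => B.br (Polynomial.aeval (pf K lam) ghat) x)^[i] a =
      (i.factorial : PQ K lam) * p.coeff i := by
    rw [← Derivation.iterate_eq_factorial_smul_coeff _ hp.derivative_eq,
      Polynomial.coeff_zero_eq_eval_zero, hp.eval_zero]
    rfl
  refine ⟨p.natDegree + 1, fun i hi => ?_, ?_⟩
  · rw [hit, Polynomial.coeff_eq_zero_of_natDegree_lt hi, mul_zero]
  · rw [← hp.eval_one, Polynomial.eval_eq_sum_range]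
    refine Finset.sum_congr rfl fun i _ => ?_
    have hi : (i.factorial : K) ≠ 0 := Nat.cast_ne_zero.mpr i.factorial_ne_zero
    rw [hit, one_pow, mul_one, ← map_natCast (algebraMap K (PQ K lam)), ← Algebra.smul_def,
      smul_smul, inv_mul_cancel₀ hi, one_smul]
end
end

section
/- J is a normal subgroup of T, T = J·H, and J ∩ H = {id}; consequently T is the internal semidirect product J ⋊ H. -/
noncomputable section

open scoped Pointwise

variable (K : Type*) [Field K] [IsAlgClosed K] [CharZero K] (lam : K)

variable {K lam}

set_option linter.unusedSectionVars false

variable {B : PoissonBr K lam}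

lemma PQ.smul_eq (c : K) (x : PQ K lam) : c • x = algebraMap K (PQ K lam) c * x :=
  Algebra.smul_def c x

/-- An automorphism of `P_λ` is determined by the images of `e`, `h`, `f`. -/
lemma PAut.ext_gens {C D : ↥(PAut B)} (he : C.val (pe K lam) = D.val (pe K lam))
    (hh : C.val (ph K lam) = D.val (ph K lam)) (hf : C.val (pf K lam) = D.val (pf K lam)) :
    C = D := by
  apply Subtype.ext
  apply AlgEquiv.coe_toAlgHom_injective
  apply Ideal.Quotient.algHom_ext
  apply MvPolynomial.algHom_ext
  intro i
  fin_cases i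
  exacts [he, hh, hf]

lemma pf_ne_zero : pf K lam ≠ 0 := by
  intro h
  rw [pf, Ideal.Quotient.eq_zero_iff_mem, Ideal.mem_span_singleton] at h
  simpa [mul_div_cancel₀] using map_dvd (MvPolynomial.eval ![lam / 4, 0, 1]) h

lemma IsDelta.map_aeval {g : Polynomial K} {D : ↥(PAut B)} (hD : IsDelta B g D)
    (p : Polynomial K) :
    D.val (Polynomial.aeval (pf K lam) p) = Polynomial.aeval (pf K lam) p := by
  rw [← Polynomial.aeval_algHom_apply, hD.2.2]

lemma IsHRot.map_aeval {β : Kˣ} {D : ↥(PAut B)} (hD : IsHRot B β D) (p : Polynomial K) :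
    D.val (Polynomial.aeval (pf K lam) p) =
      Polynomial.aeval (pf K lam) (p.comp (Polynomial.C (β : K)⁻¹ * Polynomial.X)) := by
  rw [← Polynomial.aeval_algHom_apply, hD.2.2, Polynomial.aeval_comp]
  simp [PQ.smul_eq]

lemma IsDelta.eq {g : Polynomial K} {C D : ↥(PAut B)} (hC : IsDelta B g C)
    (hD : IsDelta B g D) : C = D :=
  PAut.ext_gens (hC.1.trans hD.1.symm) (hC.2.1.trans hD.2.1.symm) (hC.2.2.trans hD.2.2.symm)

lemma IsHRot.eq {β : Kˣ} {C D : ↥(PAut B)} (hC : IsHRot B β C) (hD : IsHRot B β D) : C = D :=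
  PAut.ext_gens (hC.1.trans hD.1.symm) (hC.2.1.trans hD.2.1.symm) (hC.2.2.trans hD.2.2.symm)

lemma isDelta_zero_one : IsDelta B 0 1 := by
  simp [IsDelta]

lemma isHRot_one_one : IsHRot B 1 1 := by
  simp [IsHRot]

lemma IsDelta.mul {g k : Polynomial K} {C D : ↥(PAut B)} (hC : IsDelta B g C)
    (hD : IsDelta B k D) : IsDelta B (g + k) (C * D) := by
  refine ⟨?_, ?_, ?_⟩ <;>
    simp only [Subgroup.coe_mul, AlgEquiv.mul_apply, hD.1, hD.2.1, hD.2.2, map_sub, map_add,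
      map_mul, map_pow, map_ofNat, hC.map_aeval, hC.1, hC.2.1, hC.2.2] <;> ring

lemma IsHRot.mul {β γ : Kˣ} {C D : ↥(PAut B)} (hC : IsHRot B β C) (hD : IsHRot B γ D) :
    IsHRot B (β * γ) (C * D) := by
  refine ⟨?_, ?_, ?_⟩ <;>
    simp only [Subgroup.coe_mul, AlgEquiv.mul_apply, hD.1, hD.2.1, hD.2.2, map_smul,
      hC.1, hC.2.1, hC.2.2, smul_smul, Units.val_mul, mul_inv_rev, mul_comm]

/-- Conjugation by `H_β` sends `Δ_g` to the triangular automorphism of `β⁻¹ g(β⁻¹x)`. -/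
lemma IsHRot.conj_isDelta {β : Kˣ} {g : Polynomial K} {R S D : ↥(PAut B)}
    (hR : IsHRot B β R) (hS : IsHRot B β⁻¹ S) (hD : IsDelta B g D) :
    IsDelta B (Polynomial.C (β : K)⁻¹ * g.comp (Polynomial.C (β : K)⁻¹ * Polynomial.X))
      (R * D * S) := by
  have hβ : algebraMap K (PQ K lam) (β : K)⁻¹ * algebraMap K (PQ K lam) (β : K) = 1 := by
    rw [← map_mul, inv_mul_cancel₀ β.ne_zero, map_one]
  refine ⟨?_, ?_, ?_⟩ <;>
    simp only [Subgroup.coe_mul, AlgEquiv.mul_apply, hS.1, hS.2.1, hS.2.2, AlgEquiv.commutes,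
      map_sub, map_add, map_mul, map_pow, map_ofNat, hD.1, hD.2.1, hD.2.2, hR.1, hR.2.1, hR.2.2,
      hR.map_aeval, Polynomial.aeval_C, PQ.smul_eq, Units.val_inv_eq_inv_val, inv_inv]
  · linear_combination pe K lam * hβ
  · ring
  · linear_combination pf K lam * hβ

/-- `J` is a normal subgroup of `T`, `T = J·H`, and `J ∩ H = {id}`;
hence `T` is the internal semidirect product `J ⋊ H`. Here `J = {Δ_g : g ∈ K[x]}`,
`H = {H_β : β ∈ Kˣ}` and `T = ⟨J, H⟩`. -/
theorem triangular_semidirect (B : PoissonBr K lam)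
    (Δ : Polynomial K → ↥(PAut B)) (hΔ : ∀ g, IsDelta B g (Δ g))
    (HR : Kˣ → ↥(PAut B)) (hHR : ∀ β, IsHRot B β (HR β)) :
    (((Subgroup.closure (Set.range Δ) : Subgroup ↥(PAut B)) : Set ↥(PAut B)) = Set.range Δ) ∧
    (((Subgroup.closure (Set.range HR) : Subgroup ↥(PAut B)) : Set ↥(PAut B)) = Set.range HR) ∧
    (∀ t ∈ Subgroup.closure (Set.range Δ ∪ Set.range HR),
      ∀ j ∈ Subgroup.closure (Set.range Δ), t * j * t⁻¹ ∈ Subgroup.closure (Set.range Δ)) ∧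
    (∀ t ∈ Subgroup.closure (Set.range Δ ∪ Set.range HR),
      ∃ j ∈ Subgroup.closure (Set.range Δ), ∃ k ∈ Subgroup.closure (Set.range HR), t = j * k) ∧
    (Subgroup.closure (Set.range Δ) ⊓ Subgroup.closure (Set.range HR) = ⊥) := by
  let δ : Multiplicative (Polynomial K) →* ↥(PAut B) :=
    { toFun := fun g => Δ g.toAdd
      map_one' := (hΔ 0).eq isDelta_zero_one
      map_mul' := fun g k => (hΔ (g.toAdd + k.toAdd)).eq ((hΔ _).mul (hΔ _)) }
  let η : Kˣ →* ↥(PAut B) :=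
    { toFun := HR
      map_one' := (hHR 1).eq isHRot_one_one
      map_mul' := fun β γ => (hHR (β * γ)).eq ((hHR β).mul (hHR γ)) }
  have hJ : Subgroup.closure (Set.range Δ) = δ.range := Subgroup.closure_eq δ.range
  have hH : Subgroup.closure (Set.range HR) = η.range := Subgroup.closure_eq η.range
  have hconj : ∀ β : Kˣ, ∀ j ∈ δ.range, η β * j * (η β)⁻¹ ∈ δ.range := by
    rintro β _ ⟨g, rfl⟩
    rw [← map_inv]
    exact ⟨_, (hΔ _).eq ((hHR β).conj_isDelta (hHR β⁻¹) (hΔ g.toAdd))⟩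
  have hnorm : η.range ≤ Subgroup.normalizer (δ.range : Set ↥(PAut B)) := by
    rintro _ ⟨β, rfl⟩
    refine Subgroup.mem_normalizer_iff.mpr fun j => ⟨hconj β j, fun hj => ?_⟩
    simpa [mul_assoc] using hconj β⁻¹ _ hj
  rw [Subgroup.closure_union, hJ, hH]
  refine ⟨rfl, rfl, fun t ht j hj => ?_, fun t ht => ?_, ?_⟩
  · exact (Subgroup.mem_normalizer_iff.mp (sup_le Subgroup.le_normalizer hnorm ht) j).mp hj
  · rw [← SetLike.mem_coe, Subgroup.coe_mul_of_right_le_normalizer_left _ _ hnorm] at ht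
    obtain ⟨j, hj, k, hk, rfl⟩ := ht
    exact ⟨j, hj, k, hk, rfl⟩
  · refine (Subgroup.eq_bot_iff_forall _).mpr ?_
    rintro _ ⟨⟨g, rfl⟩, β, hβ⟩
    have hf : (β : K)⁻¹ • pf K lam = pf K lam :=
      (hHR β).2.2.symm.trans ((congrArg (fun D => D.val (pf K lam)) hβ).trans (hΔ g.toAdd).2.2)
    have hβ1 : (β : K)⁻¹ = 1 := by
      refine smul_left_injective K (pf_ne_zero (lam := lam)) ?_
      simpa using hf
    have : β = 1 := by simpa using hβ1
    rw [← hβ, this, map_one]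
end
end
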